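/- Let μ and ν be finite nonnegative Borel measures on ℝ^d with finite first moments. Then μ ≡ph ν (i.e. ∫ f dμ = ∫ f dν for every positively 1-homogeneous Borel function f : ℝ^d → ℝ that is bounded on the unit sphere) if and only if both μ ≼phc ν and ν ≼phc μ. -/

import Mathlib

open MeasureTheory Filter
open scoped ENNReal NNReal

noncomputable section

/-- `ℝ^d` with the Euclidean norm. -/
abbrev Ed (d : ℕ) := EuclideanSpace ℝ (Fin d)

/-- A support function on `ℝ^d`: convex and positively 1-homogeneous. -/
def IsSupportFunction {d : ℕ} (f : Ed d → ℝ) : Prop :=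
  ConvexOn ℝ Set.univ f ∧ ∀ (t : ℝ), 0 ≤ t → ∀ x : Ed d, f (t • x) = t * f x

/-- An unnormalized kernel: a family of finite nonnegative Borel measures,
Borel measurable in the first argument. -/
def IsUKernel {d : ℕ} (q : Ed d → Measure (Ed d)) : Prop :=
  (∀ x, IsFiniteMeasure (q x)) ∧
  ∀ A : Set (Ed d), MeasurableSet A → Measurable fun x => q x A

/-- The kernel `q` transports `μ` to `ν`. -/
def Transports {d : ℕ} (q : Ed d → Measure (Ed d)) (μ ν : Measure (Ed d)) : Prop :=
  ∀ A : Set (Ed d), MeasurableSet A → ∫⁻ x, q x A ∂μ = ν A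

/-- The kernel `q` is moment-preserving (w.r.t. the source measure `μ`):
`∫ y q^x(dy) = x` for `μ`-a.e. `x`. -/
def MomentPreserving {d : ℕ} (q : Ed d → Measure (Ed d)) (μ : Measure (Ed d)) : Prop :=
  ∀ᵐ x ∂μ, ∫ y, y ∂(q x) = x

/-- `μ ≼phc ν`: ordering by integration of support functions. -/
def PHC {d : ℕ} (μ ν : Measure (Ed d)) : Prop :=
  ∀ f : Ed d → ℝ, IsSupportFunction f → ∫ x, f x ∂μ ≤ ∫ x, f x ∂ν

/-- Positively 1-homogeneous real functions. -/
def PosHomogeneous {d : ℕ} (f : Ed d → ℝ) : Prop :=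
  ∀ (t : ℝ), 0 ≤ t → ∀ x : Ed d, f (t • x) = t * f x

/-- `μ ≡ph ν`: equality of integrals of all positively 1-homogeneous Borel functions
bounded on the unit sphere. -/
def EqPH {d : ℕ} (μ ν : Measure (Ed d)) : Prop :=
  ∀ f : Ed d → ℝ, Measurable f → PosHomogeneous f →
    (∃ C : ℝ, ∀ x : Ed d, ‖x‖ = 1 → |f x| ≤ C) →
    ∫ x, f x ∂μ = ∫ x, f x ∂ν

namespace IsSupportFunction

variable {d : ℕ} {f g : Ed d → ℝ}

theorem posHomogeneous (hf : IsSupportFunction f) : PosHomogeneous f := hf.2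

theorem continuous (hf : IsSupportFunction f) : Continuous f :=
  continuousOn_univ.1 (hf.1.continuousOn isOpen_univ)

theorem add (hf : IsSupportFunction f) (hg : IsSupportFunction g) :
    IsSupportFunction (f + g) :=
  ⟨hf.1.add hg.1, fun t ht x => by
    simp only [Pi.add_apply, hf.2 t ht, hg.2 t ht]
    ring⟩

theorem sup (hf : IsSupportFunction f) (hg : IsSupportFunction g) :
    IsSupportFunction (f ⊔ g) :=
  ⟨hf.1.sup hg.1, fun t ht x => by
    simp only [Pi.sup_apply, hf.2 t ht, hg.2 t ht, mul_max_of_nonneg _ _ ht]⟩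

theorem const_mul_norm {a : ℝ} (ha : 0 ≤ a) : IsSupportFunction fun x : Ed d => a * ‖x‖ :=
  ⟨convexOn_univ_norm.smul ha, fun t ht x => by
    simp only [norm_smul, Real.norm_of_nonneg ht]
    ring⟩

theorem inner_left (c : Ed d) : IsSupportFunction fun x : Ed d => inner ℝ c x :=
  ⟨(innerₗ (Ed d) c).convexOn convex_univ, fun t _ x => real_inner_smul_right c x t⟩

theorem exists_bound_sphere (hf : IsSupportFunction f) :
    ∃ C : ℝ, ∀ x : Ed d, ‖x‖ = 1 → |f x| ≤ C := by
  obtain ⟨C, hC⟩ := (isCompact_sphere (0 : Ed d) 1).exists_bound_of_continuousOn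
    hf.continuous.continuousOn
  exact ⟨C, fun x hx => hC x (by simpa using hx)⟩

end IsSupportFunction

section Homogeneous

variable {d : ℕ} {f : Ed d → ℝ}

theorem PosHomogeneous.map_zero (hf : PosHomogeneous f) : f 0 = 0 := by
  simpa using hf 0 le_rfl 0

theorem PosHomogeneous.norm_mul_apply_normalize (hf : PosHomogeneous f) (x : Ed d) :
    ‖x‖ * f (‖x‖⁻¹ • x) = f x := by
  rcases eq_or_ne x 0 with rfl | hx
  · simp [hf.map_zero]
  · rw [← hf _ (norm_nonneg x), smul_inv_smul₀ (norm_ne_zero_iff.2 hx)]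

theorem PosHomogeneous.abs_le_mul_norm (hf : PosHomogeneous f) {C : ℝ}
    (hC : ∀ x : Ed d, ‖x‖ = 1 → |f x| ≤ C) (x : Ed d) : |f x| ≤ C * ‖x‖ := by
  rcases eq_or_ne x 0 with rfl | hx
  · simp [hf.map_zero]
  · rw [← hf.norm_mul_apply_normalize x, abs_mul, abs_norm, mul_comm]
    gcongr
    exact hC _ (norm_smul_inv_norm (𝕜 := ℝ) hx)

theorem MeasureTheory.Integrable.of_abs_le_mul_norm {μ : Measure (Ed d)}
    (hμ : Integrable (fun x => ‖x‖) μ) (hf : Measurable f) {C : ℝ}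
    (hC : ∀ x, |f x| ≤ C * ‖x‖) : Integrable f μ :=
  (hμ.const_mul C).mono' hf.aestronglyMeasurable (Eventually.of_forall hC)

theorem IsSupportFunction.integrable (hf : IsSupportFunction f) {μ : Measure (Ed d)}
    (hμ : Integrable (fun x => ‖x‖) μ) : Integrable f μ := by
  obtain ⟨C, hC⟩ := hf.exists_bound_sphere
  exact hμ.of_abs_le_mul_norm hf.continuous.measurable (hf.posHomogeneous.abs_le_mul_norm hC)

end Homogeneous

/-- The restrictions to the unit sphere of differences of support functions. -/
def supportDifferences (d : ℕ) : Set C(Metric.sphere (0 : Ed d) 1, ℝ) :=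
  {φ | ∃ f g : Ed d → ℝ, IsSupportFunction f ∧ IsSupportFunction g ∧
    ∀ u : Metric.sphere (0 : Ed d) 1, φ u = f u - g u}

theorem separatesPointsStrongly_supportDifferences (d : ℕ) :
    (supportDifferences d).SeparatesPointsStrongly := by
  intro v x y
  obtain ⟨a, c, hx, hy⟩ : ∃ (a : ℝ) (c : Ed d),
      a + inner ℝ c (x : Ed d) = v x ∧ a + inner ℝ c (y : Ed d) = v y := by
    rcases eq_or_ne x y with rfl | hxy
    · exact ⟨v x, 0, by simp, by simp⟩
    · have hne : ‖(x : Ed d) - y‖ ^ 2 ≠ 0 :=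
        pow_ne_zero 2 (norm_ne_zero_iff.2 (sub_ne_zero.2 (Subtype.coe_injective.ne hxy)))
      set s : ℝ := (v x - v y) / ‖(x : Ed d) - y‖ ^ 2 with hs
      refine ⟨v x - inner ℝ (s • ((x : Ed d) - y)) (x : Ed d), s • ((x : Ed d) - y),
        by ring, ?_⟩
      have key : inner ℝ (s • ((x : Ed d) - y)) (x : Ed d)
          - inner ℝ (s • ((x : Ed d) - y)) (y : Ed d) = v x - v y := by
        rw [← inner_sub_right, real_inner_smul_left, real_inner_self_eq_norm_sq, hs,
          div_mul_cancel₀ _ hne]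
      linarith
  have hf : IsSupportFunction ((fun z : Ed d => max a 0 * ‖z‖) + fun z => inner ℝ c z) :=
    (IsSupportFunction.const_mul_norm (le_max_right _ _)).add (.inner_left c)
  have hg : IsSupportFunction fun z : Ed d => max (-a) 0 * ‖z‖ :=
    .const_mul_norm (le_max_right _ _)
  have ha : max a 0 - max (-a) 0 = a := by
    rcases le_total a 0 with h | h <;> simp [h]
  refine ⟨⟨fun u => ((fun z : Ed d => max a 0 * ‖z‖) + fun z => inner ℝ c z) u
      - max (-a) 0 * ‖(u : Ed d)‖,
    (hf.continuous.sub hg.continuous).comp continuous_subtype_val⟩,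
    ⟨_, _, hf, hg, fun u => rfl⟩, ?_, ?_⟩
  · simp only [ContinuousMap.coe_mk, Pi.add_apply, norm_eq_of_mem_sphere]
    linarith
  · simp only [ContinuousMap.coe_mk, Pi.add_apply, norm_eq_of_mem_sphere]
    linarith

theorem closure_supportDifferences (d : ℕ) : closure (supportDifferences d) = ⊤ := by
  refine ContinuousMap.sublattice_closure_eq_top _ ?_ ?_ ?_
    (separatesPointsStrongly_supportDifferences d)
  · exact ⟨0, _, _, .inner_left 0, .inner_left 0, fun u => by simp⟩
  · rintro φ ⟨f, g, hf, hg, hφ⟩ ψ ⟨p, q, hp, hq, hψ⟩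
    refine ⟨f + p, (g + p) ⊔ (q + f), hf.add hp, (hg.add hp).sup (hq.add hf), fun u => ?_⟩
    simp only [ContinuousMap.inf_apply, hφ, hψ, Pi.add_apply, Pi.sup_apply]
    grind
  · rintro φ ⟨f, g, hf, hg, hφ⟩ ψ ⟨p, q, hp, hq, hψ⟩
    refine ⟨(f + q) ⊔ (p + g), g + q, (hf.add hq).sup (hp.add hg), hg.add hq, fun u => ?_⟩
    simp only [ContinuousMap.sup_apply, hφ, hψ, Pi.add_apply, Pi.sup_apply]
    grind

/-- Differences of support functions are uniformly dense in the continuous functions on the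
unit sphere. -/
theorem exists_isSupportFunction_sub_approx {d : ℕ} {φ : Ed d → ℝ} (hφ : Continuous φ)
    {ε : ℝ} (hε : 0 < ε) :
    ∃ f g : Ed d → ℝ, IsSupportFunction f ∧ IsSupportFunction g ∧
      ∀ u : Ed d, ‖u‖ = 1 → |φ u - (f u - g u)| ≤ ε := by
  let Φ : C(Metric.sphere (0 : Ed d) 1, ℝ) := ⟨fun u => φ u, hφ.comp continuous_subtype_val⟩
  have hΦ : Φ ∈ closure (supportDifferences d) := by
    rw [closure_supportDifferences]
    trivial
  obtain ⟨ψ, ⟨f, g, hf, hg, hψ⟩, hdist⟩ := Metric.mem_closure_iff.1 hΦ ε hε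
  refine ⟨f, g, hf, hg, fun u hu => ?_⟩
  have h := (ContinuousMap.dist_apply_le_dist (f := Φ) (g := ψ)
    ⟨u, mem_sphere_zero_iff_norm.2 hu⟩).trans hdist.le
  rwa [Real.dist_eq, hψ] at h

/-- The image of `‖x‖ μ(dx)` under the projection `x ↦ x / ‖x‖` to the unit sphere. -/
def sphericalMeasure {d : ℕ} (μ : Measure (Ed d)) : Measure (Ed d) :=
  (μ.withDensity fun x => (‖x‖₊ : ℝ≥0∞)).map fun x => ‖x‖⁻¹ • x

section SphericalMeasure

variable {d : ℕ} {μ ν : Measure (Ed d)}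

theorem measurable_normalize : Measurable fun x : Ed d => ‖x‖⁻¹ • x :=
  measurable_norm.inv.smul measurable_id

theorem isFiniteMeasure_sphericalMeasure (hμ : Integrable (fun x => ‖x‖) μ) :
    IsFiniteMeasure (sphericalMeasure μ) := by
  have : IsFiniteMeasure (μ.withDensity fun x => (‖x‖₊ : ℝ≥0∞)) :=
    isFiniteMeasure_withDensity (by simpa [HasFiniteIntegral, enorm_eq_nnnorm] using hμ.2.ne)
  unfold sphericalMeasure
  infer_instance

theorem integral_sphericalMeasure {f : Ed d → ℝ} (hf : Measurable f) :
    ∫ x, f x ∂sphericalMeasure μ = ∫ x, ‖x‖ * f (‖x‖⁻¹ • x) ∂μ := by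
  rw [sphericalMeasure,
    integral_map measurable_normalize.aemeasurable hf.aestronglyMeasurable,
    integral_withDensity_eq_integral_smul measurable_nnnorm]
  rfl

theorem PosHomogeneous.integral_sphericalMeasure {f : Ed d → ℝ} (hf : PosHomogeneous f)
    (hfm : Measurable f) : ∫ x, f x ∂sphericalMeasure μ = ∫ x, f x ∂μ := by
  simp only [_root_.integral_sphericalMeasure hfm, hf.norm_mul_apply_normalize]

theorem abs_integral_sphericalMeasure_sub_le (hμ : Integrable (fun x => ‖x‖) μ)
    (φ : BoundedContinuousFunction (Ed d) ℝ) {f g : Ed d → ℝ}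
    (hf : IsSupportFunction f) (hg : IsSupportFunction g) {ε : ℝ}
    (h : ∀ u : Ed d, ‖u‖ = 1 → |φ u - (f u - g u)| ≤ ε) :
    |∫ x, φ x ∂sphericalMeasure μ - (∫ x, f x ∂μ - ∫ x, g x ∂μ)| ≤ ε * ∫ x, ‖x‖ ∂μ := by
  have hφm : Measurable φ := φ.continuous.measurable
  have hint : Integrable (fun x => ‖x‖ * φ (‖x‖⁻¹ • x)) μ := by
    refine hμ.of_abs_le_mul_norm (C := ‖φ‖)
      (measurable_norm.mul (hφm.comp measurable_normalize)) fun x => ?_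
    rw [abs_mul, abs_norm, mul_comm]
    gcongr
    exact φ.norm_coe_le_norm _
  have hfg : Integrable (fun x => f x - g x) μ := (hf.integrable hμ).sub (hg.integrable hμ)
  rw [integral_sphericalMeasure hφm,
    ← integral_sub (hf.integrable hμ) (hg.integrable hμ),
    ← integral_sub hint hfg, ← integral_const_mul,
    ← Real.norm_eq_abs]
  refine norm_integral_le_of_norm_le (hμ.const_mul ε) (Eventually.of_forall fun x => ?_)
  rcases eq_or_ne x 0 with rfl | hx
  · simp [hf.posHomogeneous.map_zero, hg.posHomogeneous.map_zero]
  · rw [← hf.posHomogeneous.norm_mul_apply_normalize x,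
      ← hg.posHomogeneous.norm_mul_apply_normalize x, ← mul_sub, ← mul_sub, norm_mul, norm_norm,
      mul_comm]
    gcongr
    exact h _ (norm_smul_inv_norm (𝕜 := ℝ) hx)

theorem sphericalMeasure_eq_of_integral_eq (hμ : Integrable (fun x => ‖x‖) μ)
    (hν : Integrable (fun x => ‖x‖) ν)
    (h : ∀ f : Ed d → ℝ, IsSupportFunction f → ∫ x, f x ∂μ = ∫ x, f x ∂ν) :
    sphericalMeasure μ = sphericalMeasure ν := by
  have := isFiniteMeasure_sphericalMeasure hμ
  have := isFiniteMeasure_sphericalMeasure hν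
  refine ext_of_forall_integral_eq_of_IsFiniteMeasure fun φ => eq_of_abs_sub_le_all ?_
  intro ε hε
  set M : ℝ := ∫ x, ‖x‖ ∂μ + ∫ x, ‖x‖ ∂ν with hM
  have hM0 : 0 ≤ M := by positivity
  obtain ⟨f, g, hf, hg, hfg⟩ := exists_isSupportFunction_sub_approx φ.continuous
    (show 0 < ε / (M + 1) by positivity)
  have h₁ := abs_integral_sphericalMeasure_sub_le hμ φ hf hg hfg
  have h₂ := abs_integral_sphericalMeasure_sub_le hν φ hf hg hfg
  rw [h f hf, h g hg] at h₁
  rw [abs_sub_comm] at h₂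
  calc |∫ x, φ x ∂sphericalMeasure μ - ∫ x, φ x ∂sphericalMeasure ν|
      ≤ ε / (M + 1) * ∫ x, ‖x‖ ∂μ + ε / (M + 1) * ∫ x, ‖x‖ ∂ν :=
        (abs_sub_le _ _ _).trans (add_le_add h₁ h₂)
    _ = ε * (M / (M + 1)) := by rw [hM]; ring
    _ ≤ ε := mul_le_of_le_one_right hε.le ((div_le_one (by positivity)).2 (by linarith))

end SphericalMeasure

/-- `μ ≡ph ν` iff `μ ≼phc ν` and `ν ≼phc μ`. -/
theorem eqPH_iff_phc_and_phc {d : ℕ}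
    (μ ν : Measure (Ed d)) [IsFiniteMeasure μ] [IsFiniteMeasure ν]
    (hμ : Integrable (fun x => ‖x‖) μ) (hν : Integrable (fun x => ‖x‖) ν) :
    EqPH μ ν ↔ (PHC μ ν ∧ PHC ν μ) := by
  constructor
  · intro h
    have heq (f : Ed d → ℝ) (hf : IsSupportFunction f) : ∫ x, f x ∂μ = ∫ x, f x ∂ν :=
      h f hf.continuous.measurable hf.posHomogeneous hf.exists_bound_sphere
    exact ⟨fun f hf => (heq f hf).le, fun f hf => (heq f hf).ge⟩
  · rintro ⟨hμν, hνμ⟩ f hfm hf -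
    rw [← hf.integral_sphericalMeasure (μ := μ) hfm, ← hf.integral_sphericalMeasure (μ := ν) hfm,
      sphericalMeasure_eq_of_integral_eq hμ hν fun g hg => (hμν g hg).antisymm (hνμ g hg)]
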